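/- arXiv:2003.13086 — 3 statements merged into one kernel-verified Lean document; each statement's English description precedes it below -/
import Mathlib

section
/- Let M2 be the 5×5 integer matrix with rows (0,0,1,0,0), (0,1,2,1,0), (1,2,2,1,0), (0,1,1,0,0), (0,0,0,0,1), and define the bilinear pairing ⟨x,y⟩ = xᵀ M2 y on ℝ⁵. Let K_eff ⊆ ℝ⁵ be the convex cone generated by the six vectors (1,0,0,0,0), (0,0,0,0,1), (−1,0,0,1,0), (−1,1,0,−1,0), (1,−1,1,−1,0), (−2,1,−1,2,1), and let K_nef ⊆ ℝ⁵ be the convex cone generated by the six vectors (0,1,0,0,0), (0,0,1,0,0), (0,0,0,1,0), (0,0,0,0,1), (1,1,0,0,0), (1,0,0,0,1). Then K_nef = {x ∈ ℝ⁵ : ⟨x,y⟩ ≥ 0 for all y ∈ K_eff}, and each of the six listed generators of K_nef spans an extremal ray of K_nef (so K_nef has exactly 6 extremal rays), and each of the six listed generators of K_eff spans an extremal ray of K_eff (so K_eff has exactly 6 extremal rays). -/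
open Matrix

noncomputable section

/-- The intersection pairing matrix between the MS bases (A,B,C,D,E) and (α,β,γ,δ,ε). -/
def M2 : Matrix (Fin 5) (Fin 5) ℝ :=
  !![0,0,1,0,0; 0,1,2,1,0; 1,2,2,1,0; 0,1,1,0,0; 0,0,0,0,1]

/-- The bilinear pairing ⟨x,y⟩ = xᵀ M2 y on ℝ⁵. -/
def pair2 (x y : Fin 5 → ℝ) : ℝ := x ⬝ᵥ M2.mulVec y

/-- The six generators of the effective cone in dimension 2 (coordinates (α,β,γ,δ,ε)). -/
def effGens2 : Fin 6 → Fin 5 → ℝ :=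
  ![![1,0,0,0,0], ![0,0,0,0,1], ![-1,0,0,1,0], ![-1,1,0,-1,0], ![1,-1,1,-1,0],
    ![-2,1,-1,2,1]]

/-- The six generators of the nef cone in codimension 2 (coordinates (A,B,C,D,E)). -/
def nefGens2 : Fin 6 → Fin 5 → ℝ :=
  ![![0,1,0,0,0], ![0,0,1,0,0], ![0,0,0,1,0], ![0,0,0,0,1], ![1,1,0,0,0],
    ![1,0,0,0,1]]

/-- The convex cone generated by finitely many vectors: all nonnegative real combinations. -/
def coneOf {n m : ℕ} (v : Fin m → Fin n → ℝ) : Set (Fin n → ℝ) :=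
  {x | ∃ c : Fin m → ℝ, (∀ i, 0 ≤ c i) ∧ x = ∑ i, c i • v i}

/-- A nonzero vector `v` spans an extremal ray of a cone `K` if `v ∈ K` and whenever
`v = u + w` with `u, w ∈ K`, both `u` and `w` are nonnegative multiples of `v`. -/
def SpansExtremalRay {n : ℕ} (K : Set (Fin n → ℝ)) (v : Fin n → ℝ) : Prop :=
  v ≠ 0 ∧ v ∈ K ∧ ∀ u w : Fin n → ℝ, u ∈ K → w ∈ K → v = u + w →
    (∃ a : ℝ, 0 ≤ a ∧ u = a • v) ∧ (∃ b : ℝ, 0 ≤ b ∧ w = b • v)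

theorem aux_gen_mem {n m : ℕ} (v : Fin m → Fin n → ℝ) (i : Fin m) : v i ∈ coneOf v := by
  refine ⟨Pi.single i 1, fun j => ?_, ?_⟩
  · by_cases h : j = i
    · subst h; simp
    · simp [h]
  · simp [Pi.single_apply, ite_smul]

theorem aux_span {n m : ℕ} (g : Fin m → Fin n → ℝ) (v : Fin n → ℝ)
    (h : SpansExtremalRay (coneOf g) v) : ∃ i : Fin m, ∃ a : ℝ, 0 < a ∧ v = a • g i := by
  obtain ⟨h0, ⟨c, hc, hv⟩, hex⟩ := h
  have : ∃ i, c i • g i ≠ 0 := by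
    by_contra! hh
    exact h0 (by rw [hv]; exact Finset.sum_eq_zero fun i _ => hh i)
  obtain ⟨i, hi⟩ := this
  have hci : 0 < c i := lt_of_le_of_ne (hc i) (fun h => hi (by rw [← h, zero_smul]))
  have hu : c i • g i ∈ coneOf g := by
    refine ⟨Pi.single i (c i), fun j => ?_, ?_⟩
    · by_cases h : j = i
      · subst h; simpa using hc j
      · simp [h]
    · simp [Pi.single_apply, ite_smul]
  have hw : ∑ j ∈ Finset.univ.erase i, c j • g j ∈ coneOf g := by
    refine ⟨fun j => if j = i then 0 else c j, fun j => ?_, ?_⟩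
    · dsimp only
      split_ifs
      · exact le_rfl
      · exact hc j
    · rw [← Finset.add_sum_erase _ _ (Finset.mem_univ i)]
      simp only [if_true, zero_smul, zero_add]
      refine Finset.sum_congr rfl fun j hj => ?_
      rw [if_neg (Finset.ne_of_mem_erase hj)]
  obtain ⟨⟨a, ha, hau⟩, -⟩ := hex _ _ hu hw
    (by rw [hv, Finset.add_sum_erase _ (fun j => c j • g j) (Finset.mem_univ i)])
  have ha' : 0 < a := lt_of_le_of_ne ha (fun h => hi (by rw [hau, ← h, zero_smul]))
  refine ⟨i, a⁻¹ * c i, by positivity, ?_⟩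
  rw [mul_smul, hau, smul_smul, inv_mul_cancel₀ ha'.ne', one_smul]

theorem aux_ext {n m : ℕ} (g : Fin m → Fin n → ℝ) (i : Fin m) (h0 : g i ≠ 0)
    (h : ∀ u w, u ∈ coneOf g → w ∈ coneOf g → g i = u + w → ∃ a : ℝ, 0 ≤ a ∧ u = a • g i) :
    SpansExtremalRay (coneOf g) (g i) :=
  ⟨h0, aux_gen_mem g i, fun u w hu hw e =>
    ⟨h u w hu hw e, h w u hw hu (by rw [e, add_comm])⟩⟩

theorem aux_nef (x : Fin 5 → ℝ) : x ∈ coneOf nefGens2 ↔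
    (0 ≤ x 0 ∧ 0 ≤ x 1 ∧ 0 ≤ x 2 ∧ 0 ≤ x 3 ∧ 0 ≤ x 4 ∧ x 0 ≤ x 1 + x 4) := by
  constructor
  · rintro ⟨c, hc, rfl⟩
    have h0 := hc 0
    have h1 := hc 1
    have h2 := hc 2
    have h3 := hc 3
    have h4 := hc 4
    have h5 := hc 5
    refine ⟨?_, ?_, ?_, ?_, ?_, ?_⟩ <;> simp [Fin.sum_univ_succ, nefGens2] <;> linarith
  · rintro ⟨h0, h1, h2, h3, h4, h5⟩
    have a1 := min_le_left (x 0) (x 1)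
    have a2 := min_le_right (x 0) (x 1)
    have a3 : 0 ≤ min (x 0) (x 1) := le_min h0 h1
    have a4 : x 0 - x 4 ≤ min (x 0) (x 1) := le_min (by linarith) (by linarith)
    generalize min (x 0) (x 1) = t at *
    refine ⟨![x 1 - t, x 2, x 3, x 4 - (x 0 - t), t, x 0 - t], fun i => ?_, ?_⟩
    · fin_cases i <;> simp <;> linarith
    · ext j
      fin_cases j <;> simp [Fin.sum_univ_succ, nefGens2]

theorem aux_eff (y : Fin 5 → ℝ) (hy : y ∈ coneOf effGens2) :
    0 ≤ y 1 + 2 * y 2 + y 3 ∧ 0 ≤ y 0 + 2 * y 1 + 2 * y 2 + y 3 ∧ 0 ≤ y 1 + y 2 ∧ 0 ≤ y 4 ∧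
    0 ≤ y 1 + 3 * y 2 + y 3 ∧ 0 ≤ y 2 + y 4 := by
  obtain ⟨c, hc, rfl⟩ := hy
  have h0 := hc 0
  have h1 := hc 1
  have h2 := hc 2
  have h3 := hc 3
  have h4 := hc 4
  have h5 := hc 5
  simp [Fin.sum_univ_succ, effGens2]
  refine ⟨?_, ?_, ?_, ?_, ?_, ?_⟩ <;> linarith

theorem aux_pair (x y : Fin 5 → ℝ) : pair2 x y =
    x 0 * y 2 + x 1 * (y 1 + 2 * y 2 + y 3) + x 2 * (y 0 + 2 * y 1 + 2 * y 2 + y 3)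
      + x 3 * (y 1 + y 2) + x 4 * y 4 := by
  simp [pair2, M2, dotProduct, Matrix.mulVec, Fin.sum_univ_succ]
  ring

theorem aux_dual : coneOf nefGens2 = {x | ∀ y ∈ coneOf effGens2, 0 ≤ pair2 x y} := by
  ext x
  constructor
  · rintro ⟨c, hc, rfl⟩ y hy
    obtain ⟨e1, e2, e3, e4, e5, e6⟩ := aux_eff y hy
    have h0 := mul_nonneg (hc 0) e1
    have h1 := mul_nonneg (hc 1) e2
    have h2 := mul_nonneg (hc 2) e3
    have h3 := mul_nonneg (hc 3) e4
    have h4 := mul_nonneg (hc 4) e5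
    have h5 := mul_nonneg (hc 5) e6
    rw [aux_pair]
    simp [Fin.sum_univ_succ, nefGens2]
    linarith
  · intro h
    have k : ∀ i, 0 ≤ pair2 x (effGens2 i) := fun i => h _ (aux_gen_mem _ i)
    simp only [aux_pair] at k
    have h0 := k 0
    have h1 := k 1
    have h2 := k 2
    have h3 := k 3
    have h4 := k 4
    have h5 := k 5
    simp [effGens2] at h0 h1 h2 h3 h4 h5
    rw [aux_nef]
    refine ⟨?_, ?_, ?_, ?_, ?_, ?_⟩ <;> linarith

theorem aux_nef_ext (i : Fin 6) : SpansExtremalRay (coneOf nefGens2) (nefGens2 i) := by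
  apply aux_ext
  · intro h
    have h0 := congrFun h 0
    have h1 := congrFun h 1
    have h2 := congrFun h 2
    have h3 := congrFun h 3
    have h4 := congrFun h 4
    fin_cases i <;> simp [nefGens2] at h0 h1 h2 h3 h4
  · intro u w hu hw e
    rw [aux_nef] at hu hw
    obtain ⟨u1, u2, u3, u4, u5, u6⟩ := hu
    obtain ⟨w1, w2, w3, w4, w5, w6⟩ := hw
    have h0 := congrFun e 0
    have h1 := congrFun e 1
    have h2 := congrFun e 2
    have h3 := congrFun e 3
    have h4 := congrFun e 4
    refine ⟨(![u 1, u 2, u 3, u 4, u 0, u 0] : Fin 6 → ℝ) i, ?_, ?_⟩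
    · fin_cases i <;> simpa
    · ext j
      fin_cases i <;> simp [nefGens2] at h0 h1 h2 h3 h4 <;>
        fin_cases j <;> simp [nefGens2] <;> linarith

theorem aux_eff_ext (i : Fin 6) : SpansExtremalRay (coneOf effGens2) (effGens2 i) := by
  apply aux_ext
  · intro h
    have h0 := congrFun h 0
    have h1 := congrFun h 1
    have h2 := congrFun h 2
    have h3 := congrFun h 3
    have h4 := congrFun h 4
    fin_cases i <;> simp [effGens2] at h0 h1 h2 h3 h4
  · intro u w hu hw e
    obtain ⟨u1, u2, u3, u4, u5, u6⟩ := aux_eff u hu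
    obtain ⟨w1, w2, w3, w4, w5, w6⟩ := aux_eff w hw
    have h0 := congrFun e 0
    have h1 := congrFun e 1
    have h2 := congrFun e 2
    have h3 := congrFun e 3
    have h4 := congrFun e 4
    refine ⟨(![u 0, u 4, u 3, u 1, u 2, u 1] : Fin 6 → ℝ) i, ?_, ?_⟩
    · fin_cases i <;> simp [effGens2] at h0 h1 h2 h3 h4 ⊢ <;> linarith
    · ext j
      fin_cases i <;> simp [effGens2] at h0 h1 h2 h3 h4 <;>
        fin_cases j <;> simp [effGens2] <;> linarith

theorem aux_nef_ne (i j : Fin 6) (hij : i ≠ j) (a : ℝ) : nefGens2 j ≠ a • nefGens2 i := by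
  intro h
  have h0 := congrFun h 0
  have h1 := congrFun h 1
  have h2 := congrFun h 2
  have h3 := congrFun h 3
  have h4 := congrFun h 4
  fin_cases i <;> fin_cases j <;> simp [nefGens2] at hij h0 h1 h2 h3 h4 <;> linarith

theorem aux_eff_ne (i j : Fin 6) (hij : i ≠ j) (a : ℝ) : effGens2 j ≠ a • effGens2 i := by
  intro h
  have h0 := congrFun h 0
  have h1 := congrFun h 1
  have h2 := congrFun h 2
  have h3 := congrFun h 3
  have h4 := congrFun h 4
  fin_cases i <;> fin_cases j <;> simp [effGens2] at hij h0 h1 h2 h3 h4 <;> linarith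

/-- The nef cone in codimension 2 of the Hilbert scheme of 3 points in ℙ² is dual to the
effective cone in dimension 2 under the intersection pairing; each cone has exactly the six
listed extremal rays. -/
theorem nef2_eff2_cones :
    (coneOf nefGens2 = {x | ∀ y ∈ coneOf effGens2, 0 ≤ pair2 x y}) ∧
    (∀ i : Fin 6, SpansExtremalRay (coneOf nefGens2) (nefGens2 i)) ∧
    (∀ i j : Fin 6, i ≠ j → ∀ a : ℝ, nefGens2 j ≠ a • nefGens2 i) ∧
    (∀ v, SpansExtremalRay (coneOf nefGens2) v →
      ∃ i : Fin 6, ∃ a : ℝ, 0 < a ∧ v = a • nefGens2 i) ∧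
    (∀ i : Fin 6, SpansExtremalRay (coneOf effGens2) (effGens2 i)) ∧
    (∀ i j : Fin 6, i ≠ j → ∀ a : ℝ, effGens2 j ≠ a • effGens2 i) ∧
    (∀ v, SpansExtremalRay (coneOf effGens2) v →
      ∃ i : Fin 6, ∃ a : ℝ, 0 < a ∧ v = a • effGens2 i) := by
  exact ⟨aux_dual, aux_nef_ext, aux_nef_ne, aux_span _, aux_eff_ext, aux_eff_ne, aux_span _⟩

end
end

section
/- Let M3 be the symmetric 6×6 integer matrix with rows (1,1,0,0,0,1), (1,1,0,0,0,0), (0,0,6,3,1,0), (0,0,3,1,0,0), (0,0,1,0,0,0), (1,0,0,0,0,1), and define the bilinear pairing ⟨x,y⟩ = xᵀ M3 y on ℝ⁶. Let K_eff ⊆ ℝ⁶ be the convex cone generated by the seven vectors (0,0,0,0,1,0), (−1,1,0,0,0,1), (3,−2,−1,4,−6,−1), (0,0,1,−3,3,0), (0,0,0,1,−3,0), (1,−1,0,0,0,0), (1,0,0,0,0,−1), and let K_nef ⊆ ℝ⁶ be the convex cone generated by the eight vectors (1,0,0,0,0,0), (0,1,0,0,0,0), (0,0,1,0,0,0), (0,0,0,1,0,0),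 (0,0,0,0,0,1), (0,1,0,0,1,0), (0,0,0,1,1,0), (0,0,0,0,2,1). Then K_nef = {x ∈ ℝ⁶ : ⟨x,y⟩ ≥ 0 for all y ∈ K_eff}, and each of the eight listed generators of K_nef spans an extremal ray of K_nef (so K_nef has exactly 8 extremal rays), and each of the seven listed generators of K_eff spans an extremal ray of K_eff (so K_eff has exactly 7 extremal rays). -/
open Matrix

noncomputable section

/-- The intersection pairing matrix of the MS basis (U,V,W,X,Y,Z) with itself. -/
def M3 : Matrix (Fin 6) (Fin 6) ℝ :=
  !![1,1,0,0,0,1; 1,1,0,0,0,0; 0,0,6,3,1,0; 0,0,3,1,0,0; 0,0,1,0,0,0; 1,0,0,0,0,1]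

/-- The bilinear pairing ⟨x,y⟩ = xᵀ M3 y on ℝ⁶. -/
def pair3 (x y : Fin 6 → ℝ) : ℝ := x ⬝ᵥ M3.mulVec y

/-- The seven generators of the effective cone in dimension 3 (coordinates (U,V,W,X,Y,Z)). -/
def effGens3 : Fin 7 → Fin 6 → ℝ :=
  ![![0,0,0,0,1,0], ![-1,1,0,0,0,1], ![3,-2,-1,4,-6,-1], ![0,0,1,-3,3,0],
    ![0,0,0,1,-3,0], ![1,-1,0,0,0,0], ![1,0,0,0,0,-1]]

/-- The eight generators of the nef cone in codimension 3 (coordinates (U,V,W,X,Y,Z)). -/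
def nefGens3 : Fin 8 → Fin 6 → ℝ :=
  ![![1,0,0,0,0,0], ![0,1,0,0,0,0], ![0,0,1,0,0,0], ![0,0,0,1,0,0],
    ![0,0,0,0,0,1], ![0,1,0,0,1,0], ![0,0,0,1,1,0], ![0,0,0,0,2,1]]

theorem gen_mem {n m : ℕ} (v : Fin m → Fin n → ℝ) (i : Fin m) (a : ℝ) (ha : 0 ≤ a) :
    a • v i ∈ coneOf v := by
  refine ⟨fun j => if j = i then a else 0, fun j => ?_, ?_⟩
  · dsimp only
    split_ifs <;> simp [ha]
  · simp [ite_smul]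

theorem face_aux {n m : ℕ} (v : Fin m → Fin n → ℝ) (l : Fin n → ℝ) (i : Fin m)
    (h0 : l ⬝ᵥ v i = 0) (hp : ∀ j, j ≠ i → 0 < l ⬝ᵥ v j) (u : Fin n → ℝ) (hu : u ∈ coneOf v) :
    0 ≤ l ⬝ᵥ u ∧ (l ⬝ᵥ u = 0 → ∃ a : ℝ, 0 ≤ a ∧ u = a • v i) := by
  obtain ⟨c, hc, rfl⟩ := hu
  have e : l ⬝ᵥ (∑ j, c j • v j) = ∑ j, c j * (l ⬝ᵥ v j) := by
    simp [dotProduct_sum, dotProduct_smul]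
  have hnn : ∀ j ∈ Finset.univ, 0 ≤ c j * (l ⬝ᵥ v j) := by
    intro j _
    by_cases h : j = i
    · subst h; simp [h0]
    · exact mul_nonneg (hc j) (hp j h).le
  rw [e]
  refine ⟨Finset.sum_nonneg hnn, fun h => ⟨c i, hc i, ?_⟩⟩
  rw [Finset.sum_eq_zero_iff_of_nonneg hnn] at h
  apply Finset.sum_eq_single i
  · intro j _ hj
    have := h j (Finset.mem_univ j)
    rcases mul_eq_zero.mp this with h' | h'
    · simp [h']
    · exact absurd h' (hp j hj).ne'
  · simp

theorem extremal_aux {n m : ℕ} (v : Fin m → Fin n → ℝ) (l : Fin n → ℝ) (i : Fin m)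
    (hv : v i ≠ 0) (h0 : l ⬝ᵥ v i = 0) (hp : ∀ j, j ≠ i → 0 < l ⬝ᵥ v j) :
    SpansExtremalRay (coneOf v) (v i) := by
  refine ⟨hv, by simpa using gen_mem v i 1 zero_le_one, fun u w hu hw h => ?_⟩
  obtain ⟨u0, hu'⟩ := face_aux v l i h0 hp u hu
  obtain ⟨w0, hw'⟩ := face_aux v l i h0 hp w hw
  have : l ⬝ᵥ u + l ⬝ᵥ w = 0 := by rw [← dotProduct_add, ← h, h0]
  exact ⟨hu' (by linarith), hw' (by linarith)⟩

theorem only_aux {n m : ℕ} (v : Fin m → Fin n → ℝ) (x : Fin n → ℝ)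
    (hx : SpansExtremalRay (coneOf v) x) : ∃ i, ∃ a : ℝ, 0 < a ∧ x = a • v i := by
  obtain ⟨hx0, ⟨c, hc, he⟩, hs⟩ := hx
  have : ∃ i, c i • v i ≠ 0 := by
    by_contra! h
    exact hx0 (by rw [he]; exact Finset.sum_eq_zero fun i _ => h i)
  obtain ⟨i, hi⟩ := this
  have hci : 0 < c i := lt_of_le_of_ne (hc i) (fun h => hi (by simp [← h]))
  have hrest : (∑ j, (if j = i then 0 else c j) • v j) ∈ coneOf v := by
    refine ⟨_, fun j => ?_, rfl⟩
    split_ifs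
    · exact le_rfl
    · exact hc j
  have hsum : x = c i • v i + ∑ j, (if j = i then 0 else c j) • v j := by
    have h1 : c i • v i = ∑ j, (if j = i then c j else 0) • v j := by simp [ite_smul]
    rw [h1, ← Finset.sum_add_distrib, he]
    refine Finset.sum_congr rfl fun j _ => ?_
    split_ifs <;> simp
  obtain ⟨⟨a, ha, hax⟩, -⟩ := hs _ _ (gen_mem v i (c i) (hc i)) hrest hsum
  have ha0 : a ≠ 0 := fun h => hi (by rw [hax, h, zero_smul])
  have hapos : 0 < a := lt_of_le_of_ne ha (Ne.symm ha0)
  refine ⟨i, a⁻¹ * c i, by positivity, ?_⟩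
  rw [mul_smul, hax, smul_smul, inv_mul_cancel₀ ha0, one_smul]

theorem nonprop_aux {n m : ℕ} (v : Fin m → Fin n → ℝ) (l : Fin n → ℝ) (i : Fin m)
    (h0 : l ⬝ᵥ v i = 0) (hp : ∀ j, j ≠ i → 0 < l ⬝ᵥ v j) (j : Fin m) (hij : i ≠ j) (a : ℝ) :
    v j ≠ a • v i := by
  intro h
  have := hp j hij.symm
  rw [h, dotProduct_smul, h0] at this
  simp at this

def nefL : Fin 8 → Fin 6 → ℝ :=
  ![![0,1,1,1,1,1], ![1,0,1,1,1,1], ![1,1,0,1,1,1], ![1,1,1,0,1,1],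
    ![1,1,1,1,1,0], ![1,1,1,2,-1,3], ![1,2,1,1,-1,3], ![1,2,1,2,-1,2]]

def effL : Fin 7 → Fin 6 → ℝ :=
  ![![3,2,4,1,0,2], ![2,1,10,4,1,1], ![3,2,13,4,1,2], ![3,2,9,4,1,2],
    ![3,2,7,3,1,2], ![2,2,10,4,1,1], ![2,1,10,4,1,2]]

theorem nefL0 (i : Fin 8) : nefL i ⬝ᵥ nefGens3 i = 0 := by
  fin_cases i <;> simp [nefL, nefGens3, dotProduct, Fin.sum_univ_succ] <;> norm_num

theorem nefLp (i j : Fin 8) (h : j ≠ i) : 0 < nefL i ⬝ᵥ nefGens3 j := by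
  fin_cases i <;> fin_cases j <;> first
    | exact absurd rfl h
    | (simp [nefL, nefGens3, dotProduct, Fin.sum_univ_succ] <;> norm_num)

theorem effL0 (i : Fin 7) : effL i ⬝ᵥ effGens3 i = 0 := by
  fin_cases i <;> simp [effL, effGens3, dotProduct, Fin.sum_univ_succ] <;> norm_num

theorem effLp (i j : Fin 7) (h : j ≠ i) : 0 < effL i ⬝ᵥ effGens3 j := by
  fin_cases i <;> fin_cases j <;> first
    | exact absurd rfl h
    | (simp [effL, effGens3, dotProduct, Fin.sum_univ_succ] <;> norm_num)

theorem nef_ne (i : Fin 8) : nefGens3 i ≠ 0 := by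
  intro h
  obtain ⟨k, hk⟩ : ∃ k : Fin 8, i ≠ k := exists_ne i |>.imp fun _ h => h.symm
  have := nefLp k i hk
  rw [h] at this
  simp at this

theorem eff_ne (i : Fin 7) : effGens3 i ≠ 0 := by
  intro h
  obtain ⟨k, hk⟩ : ∃ k : Fin 7, i ≠ k := exists_ne i |>.imp fun _ h => h.symm
  have := effLp k i hk
  rw [h] at this
  simp at this

theorem pair_formula (x y : Fin 6 → ℝ) : pair3 x y =
    x 0 * (y 0 + y 1 + y 5) + x 1 * (y 0 + y 1) + x 2 * (6 * y 2 + 3 * y 3 + y 4)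
    + x 3 * (3 * y 2 + y 3) + x 4 * y 2 + x 5 * (y 0 + y 5) := by
  simp [pair3, M3, dotProduct, mulVec, Fin.sum_univ_six]

theorem nef_comb (c : Fin 8 → ℝ) : ∑ i, c i • nefGens3 i =
    ![c 0, c 1 + c 5, c 2, c 3 + c 6, c 5 + c 6 + 2 * c 7, c 4 + c 7] := by
  ext k
  fin_cases k <;> simp [Fin.sum_univ_eight, nefGens3] <;> ring

theorem eff_comb (c : Fin 7 → ℝ) : ∑ i, c i • effGens3 i =
    ![-c 1 + 3 * c 2 + c 5 + c 6, c 1 - 2 * c 2 - c 5, -c 2 + c 3, 4 * c 2 - 3 * c 3 + c 4,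
      c 0 - 6 * c 2 + 3 * c 3 - 3 * c 4, c 1 - c 2 - c 6] := by
  ext k
  fin_cases k <;> simp [Fin.sum_univ_seven, effGens3] <;> ring

theorem pair_comb (x : Fin 6 → ℝ) (d : Fin 7 → ℝ) : pair3 x (∑ i, d i • effGens3 i) =
    d 0 * x 2 + d 1 * x 0 + d 2 * (x 1 + x 3 - x 4 + 2 * x 5) + d 3 * x 4 + d 4 * x 3
    + d 5 * x 5 + d 6 * x 1 := by
  rw [eff_comb, pair_formula]
  simp
  ring

theorem mem_nef {x : Fin 6 → ℝ} (h0 : 0 ≤ x 0) (h1 : 0 ≤ x 1) (h2 : 0 ≤ x 2) (h3 : 0 ≤ x 3)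
    (h4 : 0 ≤ x 4) (h5 : 0 ≤ x 5) (hf : 0 ≤ x 1 + x 3 - x 4 + 2 * x 5) :
    x ∈ coneOf nefGens3 := by
  obtain ⟨p, q, r, hp, hq, hr, hp', hq', hr', e⟩ : ∃ p q r : ℝ, 0 ≤ p ∧ 0 ≤ q ∧ 0 ≤ r ∧
      p ≤ x 1 ∧ q ≤ x 3 ∧ r ≤ x 5 ∧ p + q + 2 * r = x 4 := by
    by_cases a : x 4 ≤ x 1
    · exact ⟨x 4, 0, 0, h4, le_rfl, le_rfl, a, h3, h5, by ring⟩
    · by_cases b : x 4 ≤ x 1 + x 3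
      · exact ⟨x 1, x 4 - x 1, 0, h1, by linarith, le_rfl, le_rfl, by linarith, h5, by ring⟩
      · exact ⟨x 1, x 3, (x 4 - x 1 - x 3) / 2, h1, h3, by linarith, le_rfl, le_rfl,
          by linarith, by ring⟩
  refine ⟨![x 0, x 1 - p, x 2, x 3 - q, x 5 - r, p, q, r], fun i => ?_, ?_⟩
  · fin_cases i <;> simp <;> assumption
  · rw [nef_comb]
    ext k
    fin_cases k <;> simp
    exact e.symm

theorem dual_eq : coneOf nefGens3 = {x | ∀ y ∈ coneOf effGens3, 0 ≤ pair3 x y} := by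
  ext x
  constructor
  · rintro ⟨c, hc, rfl⟩ y ⟨d, hd, rfl⟩
    rw [pair_comb, nef_comb]
    have a0 := hc 0
    have a1 := hc 1
    have a2 := hc 2
    have a3 := hc 3
    have a4 := hc 4
    have a5 := hc 5
    have a6 := hc 6
    have a7 := hc 7
    have e : c 1 + c 5 + (c 3 + c 6) - (c 5 + c 6 + 2 * c 7) + 2 * (c 4 + c 7)
      = c 1 + c 3 + 2 * c 4 := by ring
    have b0 := hd 0
    have b1 := hd 1
    have b2 := hd 2
    have b3 := hd 3
    have b4 := hd 4
    have b5 := hd 5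
    have b6 := hd 6
    simp only [cons_val]
    rw [e]
    positivity
  · intro h
    have key : ∀ i, 0 ≤ pair3 x (∑ j, (Pi.single i 1 : Fin 7 → ℝ) j • effGens3 j) := fun i =>
      h _ ⟨_, fun j => by by_cases hj : j = i <;> simp [Pi.single_apply, hj], rfl⟩
    simp only [pair_comb] at key
    have k0 := key 0
    have k1 := key 1
    have k2 := key 2
    have k3 := key 3
    have k4 := key 4
    have k5 := key 5
    have k6 := key 6
    simp [Pi.single_apply] at k0 k1 k2 k3 k4 k5 k6
    apply mem_nef <;> linarith

/-- The nef cone in codimension 3 of the Hilbert scheme of 3 points in ℙ² is dual to the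
effective cone in dimension 3 under the intersection pairing; the nef cone has exactly the
eight listed extremal rays and the effective cone has exactly the seven listed ones. -/
theorem nef3_eff3_cones :
    (coneOf nefGens3 = {x | ∀ y ∈ coneOf effGens3, 0 ≤ pair3 x y}) ∧
    (∀ i : Fin 8, SpansExtremalRay (coneOf nefGens3) (nefGens3 i)) ∧
    (∀ i j : Fin 8, i ≠ j → ∀ a : ℝ, nefGens3 j ≠ a • nefGens3 i) ∧
    (∀ v, SpansExtremalRay (coneOf nefGens3) v →
      ∃ i : Fin 8, ∃ a : ℝ, 0 < a ∧ v = a • nefGens3 i) ∧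
    (∀ i : Fin 7, SpansExtremalRay (coneOf effGens3) (effGens3 i)) ∧
    (∀ i j : Fin 7, i ≠ j → ∀ a : ℝ, effGens3 j ≠ a • effGens3 i) ∧
    (∀ v, SpansExtremalRay (coneOf effGens3) v →
      ∃ i : Fin 7, ∃ a : ℝ, 0 < a ∧ v = a • effGens3 i) := by
  exact ⟨dual_eq,
    fun i => extremal_aux _ (nefL i) i (nef_ne i) (nefL0 i) (nefLp i),
    fun i j hij a => nonprop_aux _ (nefL i) i (nefL0 i) (nefLp i) j hij a,
    only_aux _,
    fun i => extremal_aux _ (effL i) i (eff_ne i) (effL0 i) (effLp i),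
    fun i j hij a => nonprop_aux _ (effL i) i (effL0 i) (effLp i) j hij a,
    only_aux _⟩

end
end

section
/- Let k be a field, let C₁, C₂ ∈ k[x,y] be polynomials, and let z₁, z₂, z₃ ∈ k² be points such that C₂(zᵢ) = 0 and C₁(zᵢ) ≠ 0 for i = 1,2,3. For 1 ≤ i < j ≤ 3 define f_{ij} : (k²)³ → k by f_{ij}(w₁,w₂,w₃) = C₁(wᵢ)·C₂(w_j) − C₁(w_j)·C₂(wᵢ). Then the kernel of the total derivative (Jacobian) of the map (f₁₂, f₁₃, f₂₃) : (k²)³ → k³ at the point (z₁,z₂,z₃) is exactly the set of triples (v₁,v₂,v₃) ∈ (k²)³ for which there exists t ∈ k with ∇C₂(zᵢ)·vᵢ = t·C₁(zᵢ) for all i = 1,2,3, where ∇C₂ denotes the vector of formal partial derivatives of C₂. In particular, if ∇C₂(zᵢ) ≠ 0 for all i, this kernel is a 4-dimensional linear subspace of (k²)³ ≅ k⁶. -/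
open MvPolynomial

noncomputable section

/-- The polynomial f_{ij}(w₁,w₂,w₃) = C₁(wᵢ)·C₂(w_j) − C₁(w_j)·C₂(wᵢ) on (k²)³,
as a polynomial in the six variables indexed by `Fin 3 × Fin 2`. -/
def fPoly {k : Type*} [Field k] (C₁ C₂ : MvPolynomial (Fin 2) k) (i j : Fin 3) :
    MvPolynomial (Fin 3 × Fin 2) k :=
  (rename (fun t => (i, t)) C₁) * (rename (fun t => (j, t)) C₂)
    - (rename (fun t => (j, t)) C₁) * (rename (fun t => (i, t)) C₂)

/-- The three pairs (i,j) with 1 ≤ i < j ≤ 3 (zero-indexed). -/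
def pairs3 : Fin 3 → Fin 3 × Fin 3 := ![(0, 1), (0, 2), (1, 2)]

/-- The Jacobian matrix of the map (f₁₂, f₁₃, f₂₃) : (k²)³ → k³ at the point
(z₁,z₂,z₃), given by the formal partial derivatives of the f_{ij}. -/
def jacMat {k : Type*} [Field k] (C₁ C₂ : MvPolynomial (Fin 2) k) (z : Fin 3 → Fin 2 → k) :
    Matrix (Fin 3) (Fin 3 × Fin 2) k :=
  fun p s =>
    eval (fun q : Fin 3 × Fin 2 => z q.1 q.2)
      (pderiv s (fPoly C₁ C₂ (pairs3 p).1 (pairs3 p).2))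

lemma eval_pderiv_ren {k : Type*} [Field k] (C : MvPolynomial (Fin 2) k)
    (z : Fin 3 → Fin 2 → k) (i a : Fin 3) (s : Fin 2) :
    eval (fun q : Fin 3 × Fin 2 => z q.1 q.2) (pderiv (a, s) (rename (fun t => (i, t)) C)) =
      if a = i then eval (z i) (pderiv s C) else 0 := by
  split_ifs with h
  · subst h
    have hinj : Function.Injective (fun t : Fin 2 => (a, t)) := fun x y h => by simpa using h
    have := pderiv_rename (R := k) hinj s C
    rw [this, eval_rename]
    rfl
  · rw [pderiv_eq_zero_of_notMem_vars, map_zero]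
    intro hm
    classical
    have := vars_rename _ _ hm
    simp only [Finset.mem_image, Prod.mk.injEq] at this
    obtain ⟨_, _, h', _⟩ := this
    exact h h'.symm

lemma eval_ren {k : Type*} [Field k] (C : MvPolynomial (Fin 2) k)
    (z : Fin 3 → Fin 2 → k) (i : Fin 3) :
    eval (fun q : Fin 3 × Fin 2 => z q.1 q.2) (rename (fun t => (i, t)) C) = eval (z i) C := by
  rw [eval_rename]
  rfl

lemma jac_mulVec {k : Type*} [Field k]
    (C₁ C₂ : MvPolynomial (Fin 2) k) (z : Fin 3 → Fin 2 → k)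
    (h2 : ∀ i : Fin 3, eval (z i) C₂ = 0) (v : Fin 3 × Fin 2 → k) (p : Fin 3) :
    (jacMat C₁ C₂ z).mulVec v p =
      eval (z (pairs3 p).1) C₁ *
        (∑ s : Fin 2, eval (z (pairs3 p).2) (pderiv s C₂) * v ((pairs3 p).2, s)) -
      eval (z (pairs3 p).2) C₁ *
        (∑ s : Fin 2, eval (z (pairs3 p).1) (pderiv s C₂) * v ((pairs3 p).1, s)) := by
  have key : ∀ a s, jacMat C₁ C₂ z p (a, s) =
      eval (z (pairs3 p).1) C₁ * (if a = (pairs3 p).2 then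
          eval (z (pairs3 p).2) (pderiv s C₂) else 0) -
      eval (z (pairs3 p).2) C₁ * (if a = (pairs3 p).1 then
          eval (z (pairs3 p).1) (pderiv s C₂) else 0) := by
    intro a s
    simp only [jacMat, fPoly, map_sub, Derivation.leibniz, smul_eq_mul, map_add, map_mul,
      eval_pderiv_ren, eval_ren, h2]
    ring
  simp only [Matrix.mulVec, dotProduct, Fintype.sum_prod_type, key]
  generalize (pairs3 p).1 = i
  generalize (pairs3 p).2 = j
  fin_cases i <;> fin_cases j <;> simp [Fin.sum_univ_three, Fin.sum_univ_two] <;> ring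

/-- The map v ↦ (∇C₂(zᵢ)·vᵢ)ᵢ. -/
def gradMap {k : Type*} [Field k] (C : MvPolynomial (Fin 2) k) (z : Fin 3 → Fin 2 → k)
    (i : Fin 3) : (Fin 3 × Fin 2 → k) →ₗ[k] k :=
  ∑ s : Fin 2, eval (z i) (pderiv s C) • LinearMap.proj (i, s)

lemma gradMap_apply {k : Type*} [Field k] (C : MvPolynomial (Fin 2) k)
    (z : Fin 3 → Fin 2 → k) (i : Fin 3) (v : Fin 3 × Fin 2 → k) :
    gradMap C z i v = ∑ s : Fin 2, eval (z i) (pderiv s C) * v (i, s) := by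
  simp [gradMap]

lemma mem_ker_jac {k : Type*} [Field k]
    (C₁ C₂ : MvPolynomial (Fin 2) k) (z : Fin 3 → Fin 2 → k)
    (h2 : ∀ i : Fin 3, eval (z i) C₂ = 0) (h1 : ∀ i : Fin 3, eval (z i) C₁ ≠ 0)
    (v : Fin 3 × Fin 2 → k) :
    v ∈ LinearMap.ker (Matrix.mulVecLin (jacMat C₁ C₂ z)) ↔
      eval (z 0) C₁ * gradMap C₂ z 1 v - eval (z 1) C₁ * gradMap C₂ z 0 v = 0 ∧
      eval (z 0) C₁ * gradMap C₂ z 2 v - eval (z 2) C₁ * gradMap C₂ z 0 v = 0 := by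
  rw [LinearMap.mem_ker, Matrix.mulVecLin_apply, funext_iff]
  simp only [jac_mulVec C₁ C₂ z h2, ← gradMap_apply, Fin.forall_fin_succ, pairs3]
  simp
  intro ha hb
  have h0 := h1 0
  apply mul_left_cancel₀ h0
  linear_combination (eval (z 1) C₁) * hb - (eval (z 2) C₁) * ha

/-- If C₂(zᵢ) = 0 and C₁(zᵢ) ≠ 0 for i = 1,2,3, then the kernel of the Jacobian of
(f₁₂, f₁₃, f₂₃) at (z₁,z₂,z₃) is exactly the set of triples (v₁,v₂,v₃) for which there is
t ∈ k with ∇C₂(zᵢ)·vᵢ = t·C₁(zᵢ) for all i; in particular, if ∇C₂(zᵢ) ≠ 0 for all i, this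
kernel is a 4-dimensional subspace of k⁶. -/
theorem jacobian_kernel_of_pencil {k : Type*} [Field k]
    (C₁ C₂ : MvPolynomial (Fin 2) k) (z : Fin 3 → Fin 2 → k)
    (h2 : ∀ i : Fin 3, eval (z i) C₂ = 0) (h1 : ∀ i : Fin 3, eval (z i) C₁ ≠ 0) :
    ((LinearMap.ker (Matrix.mulVecLin (jacMat C₁ C₂ z)) :
        Submodule k ((Fin 3 × Fin 2) → k)) : Set ((Fin 3 × Fin 2) → k)) =
      {v | ∃ t : k, ∀ i : Fin 3,
        (∑ s : Fin 2, eval (z i) (pderiv s C₂) * v (i, s)) = t * eval (z i) C₁} ∧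
    ((∀ i : Fin 3, ∃ s : Fin 2, eval (z i) (pderiv s C₂) ≠ 0) →
      Module.finrank k (LinearMap.ker (Matrix.mulVecLin (jacMat C₁ C₂ z))) = 4) := by
  constructor
  · ext v
    rw [SetLike.mem_coe, mem_ker_jac C₁ C₂ z h2 h1]
    simp only [Set.mem_ofPred_eq, ← gradMap_apply]
    constructor
    · rintro ⟨ha, hb⟩
      have h0 := h1 0
      refine ⟨gradMap C₂ z 0 v / eval (z 0) C₁, ?_⟩
      intro i
      rw [div_mul_eq_mul_div, eq_div_iff h0]
      fin_cases i
      · rfl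
      · simp only [Fin.mk_one]
        linear_combination ha
      · simp only [Fin.reduceFinMk]
        linear_combination hb
    · rintro ⟨t, ht⟩
      rw [ht 0, ht 1, ht 2]
      constructor <;> ring
  · intro hg
    choose σ hσ using hg
    let M : (Fin 3 × Fin 2 → k) →ₗ[k] k × k :=
      (eval (z 0) C₁ • gradMap C₂ z 1 - eval (z 1) C₁ • gradMap C₂ z 0).prod
        (eval (z 0) C₁ • gradMap C₂ z 2 - eval (z 2) C₁ • gradMap C₂ z 0)
    have hker : LinearMap.ker (Matrix.mulVecLin (jacMat C₁ C₂ z)) = LinearMap.ker M := by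
      ext v
      rw [mem_ker_jac C₁ C₂ z h2 h1]
      simp [M]
    have hsurj : ∀ y : Fin 3 → k, ∃ v, ∀ i, gradMap C₂ z i v = y i := by
      intro y
      refine ⟨fun q => if q.2 = σ q.1 then y q.1 / eval (z q.1) (pderiv (σ q.1) C₂) else 0, ?_⟩
      intro i
      rw [gradMap_apply]
      simp only [mul_ite, mul_zero, Finset.sum_ite_eq', Finset.mem_univ, if_true]
      exact mul_div_cancel₀ _ (hσ i)
    have hM : LinearMap.range M = ⊤ := by
      rw [LinearMap.range_eq_top]
      rintro ⟨a, b⟩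
      obtain ⟨v, hv⟩ := hsurj ![0, a / eval (z 0) C₁, b / eval (z 0) C₁]
      have h0 := h1 0
      refine ⟨v, ?_⟩
      simp [M, hv]
      constructor <;> field_simp
    have hr := LinearMap.finrank_range_add_finrank_ker M
    rw [hM, finrank_top] at hr
    simp at hr
    rw [hker]
    omega

end
end
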